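/- Let d ≥ 2, 1 ≤ m ≤ d−1, λ ∈ (0,1/2), γ ∈ ℝ, and let 𝔇 = m log 2 / log(1/λ). Then there is a constant C = C(d,m,λ,γ) such that for every x̄ ∈ ℝ^m and every radius r ∈ (0,1), the Cantor measure of the ball satisfies μ^m_{λ,γ}(B^m_r(x̄)) ≤ C · 1_{{dist(x̄, 𝔠^m_{λ,γ}) ≤ r}} · r^𝔇 · (log(e + r^{−1}))^{−γ𝔇}. -/

import Mathlib

open MeasureTheory Real Set Metric Filter Topology NNReal ENNReal

noncomputable section

/-- `ℝ^n` with the Euclidean structure. -/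
abbrev Euc (n : ℕ) := EuclideanSpace ℝ (Fin n)

/-- The open cube `(-1,1)^n`. -/
def Box (n : ℕ) : Set (Euc n) := {x | ∀ i, |x i| < 1}

/-- The last coordinate `x_d` of `x ∈ ℝ^{n+1}`. -/
def lastC {n : ℕ} (x : Euc (n + 1)) : ℝ := x (Fin.last n)

/-- The first `n` coordinates `x̄` of `x ∈ ℝ^{n+1}`. -/
def frontC {n : ℕ} (x : Euc (n + 1)) : Euc n := WithLp.toLp 2 (fun i => x i.castSucc)

/-- Assemble a point of `ℝ^{n+1}` from `x̄ ∈ ℝ^n` and a last coordinate. -/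
def snocC {n : ℕ} (xb : Euc n) (t : ℝ) : Euc (n + 1) :=
  WithLp.toLp 2 (Fin.snoc (α := fun _ => ℝ) (WithLp.ofLp xb) t)

/-- The first `m` coordinates of `x ∈ ℝ^{m+k}`. -/
def barPart {m k : ℕ} (x : Euc (m + k)) : Euc m := WithLp.toLp 2 (fun i => x (Fin.castAdd k i))

/-- The last `k` coordinates of `x ∈ ℝ^{m+k}`. -/
def hatPart {m k : ℕ} (x : Euc (m + k)) : Euc k := WithLp.toLp 2 (fun i => x (Fin.natAdd m i))

/-- Admissibility of a sequence of interval lengths for the generalized `(λ,γ)`-Cantor set: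
`l 0 = 1`, the lengths decrease fast enough (`l_{j-1} > 2 l_j`, removed gaps decreasing), and
`l j` is comparable to `λ^j j^γ`. -/
def IsCantorLengths (lam gam : ℝ) (l : ℕ → ℝ) : Prop :=
  l 0 = 1 ∧ (∀ j, 0 < l j) ∧ (∀ j, 2 * l (j + 1) < l j) ∧
    (∀ j, l (j + 1) - 2 * l (j + 2) < l j - 2 * l (j + 1)) ∧
    ∃ C : ℝ, 1 ≤ C ∧ ∀ j : ℕ, 1 ≤ j →
      C⁻¹ * lam ^ j * (j : ℝ) ^ gam ≤ l j ∧ l j ≤ C * lam ^ j * (j : ℝ) ^ gam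

/-- The point of the generalized Cantor set with address `ε` (left endpoints of the nested
intervals converge to this point). -/
def gCantorPoint (l : ℕ → ℝ) (ε : ℕ → Bool) : ℝ :=
  -(1 / 2 : ℝ) + ∑' j : ℕ, if ε j then l j - l (j + 1) else 0

/-- The generalized Cantor set determined by the lengths `l`. -/
def gCantorSet (l : ℕ → ℝ) : Set ℝ := Set.range (gCantorPoint l)

/-- The `m`-fold Cartesian power of the generalized Cantor set, inside `ℝ^m`. -/
def gCantorSetPi (l : ℕ → ℝ) (m : ℕ) : Set (Euc m) := {x | ∀ i, x i ∈ gCantorSet l}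

/-- The `j`-th binary digit of `t`. -/
def binDigit (t : ℝ) (j : ℕ) : Bool := ⌊t * 2 ^ (j + 1)⌋ % 2 = 1

/-- The Cantor measure attached to the lengths `l`: the image of the uniform distribution on
`[0,1)` under the map sending `t` to the Cantor point whose address is the binary digit
sequence of `t` (the digits being i.i.d. fair coins, this is the weak limit of the uniform
distributions on the pre-Cantor sets). -/
def gCantorMeasure (l : ℕ → ℝ) : Measure ℝ :=
  Measure.map (fun t => gCantorPoint l (binDigit t)) (volume.restrict (Set.Ico (0 : ℝ) 1))

/-- The `m`-fold product of the Cantor measure, as a measure on `ℝ^m`. -/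
def gCantorMeasurePi (l : ℕ → ℝ) (m : ℕ) : Measure (Euc m) :=
  Measure.map (⇑(MeasurableEquiv.toLp 2 (Fin m → ℝ)))
    (Measure.pi fun _ : Fin m => gCantorMeasure l)

/-- The fractal dimension `𝔇 = m log 2 / log(1/λ)`. -/
def frD (m : ℕ) (lam : ℝ) : ℝ := m * Real.log 2 / Real.log lam⁻¹

/-- `G` is the weak (distributional) differential of `u` on `Ω`:
integration by parts against smooth compactly supported test functions holds. -/
def HasWeakFDerivOn {n : ℕ} (Ω : Set (Euc n)) (u : Euc n → ℝ)
    (G : Euc n → Euc n →L[ℝ] ℝ) : Prop :=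
  ∀ φ : Euc n → ℝ, ContDiff ℝ (⊤ : ℕ∞) φ → HasCompactSupport φ → tsupport φ ⊆ Ω →
    ∫ x in Ω, u x • fderiv ℝ φ x = -∫ x in Ω, φ x • G x

/-- `u ∈ W^{1,1}(Ω)` with weak differential `G`. -/
def W11On {n : ℕ} (Ω : Set (Euc n)) (u : Euc n → ℝ) (G : Euc n → Euc n →L[ℝ] ℝ) : Prop :=
  IntegrableOn u Ω ∧ IntegrableOn G Ω ∧ HasWeakFDerivOn Ω u G

/-- `w ∈ W^{1,1}_0(Ω)` (with weak differential `G`): the extensions by zero form a Sobolev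
function on all of `ℝ^n`. -/
def ZeroBoundary {n : ℕ} (Ω : Set (Euc n)) (w : Euc n → ℝ)
    (G : Euc n → Euc n →L[ℝ] ℝ) : Prop :=
  Integrable (Set.indicator Ω w) ∧ Integrable (Set.indicator Ω G) ∧
    HasWeakFDerivOn Set.univ (Set.indicator Ω w) (Set.indicator Ω G)

/-- The energy `∫_Ω φ(x, g x) dx` for a scalar field `g` (typically `g = |∇w|`). -/
def energyOf {n : ℕ} (Ω : Set (Euc n)) (φ : Euc n → ℝ → ℝ) (g : Euc n → ℝ) : ℝ≥0∞ :=
  ∫⁻ x in Ω, ENNReal.ofReal (φ x (g x))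

/-- The Young (Legendre–Fenchel) conjugate `φ*(s) = sup_{t ≥ 0} (s t − φ(t))`. -/
def conjOrlicz (φ : ℝ → ℝ) (s : ℝ) : ℝ≥0∞ :=
  ⨆ t : ℝ≥0, ENNReal.ofReal (s * t - φ t)

/-- The conjugate energy `∫_Ω φ*(x, g x) dx`. -/
def energyConj {n : ℕ} (Ω : Set (Euc n)) (φ : Euc n → ℝ → ℝ) (g : Euc n → ℝ) : ℝ≥0∞ :=
  ∫⁻ x in Ω, conjOrlicz (φ x) (g x)

/-- `u` (with weak differential `G`, finite energy) is a local minimizer of the functional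
`w ↦ ∫_Ω φ(x,|∇w|) dx`: its energy does not exceed that of any Sobolev competitor that agrees
with `u` a.e. outside a compact subset of `Ω`. -/
def IsLocalMinimizer {n : ℕ} (Ω : Set (Euc n)) (φ : Euc n → ℝ → ℝ) (u : Euc n → ℝ)
    (G : Euc n → Euc n →L[ℝ] ℝ) : Prop :=
  W11On Ω u G ∧ energyOf Ω φ (fun x => ‖G x‖) < ⊤ ∧
    ∀ v Gv, W11On Ω v Gv →
      (∃ K : Set (Euc n), IsCompact K ∧ K ⊆ Ω ∧ ∀ᵐ x ∂(volume.restrict Ω), x ∉ K → v x = u x) →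
      energyOf Ω φ (fun x => ‖G x‖) ≤ energyOf Ω φ (fun x => ‖Gv x‖)

/-- `x` is a non-Lebesgue point of `u`: the averages of `|u − c|` on small balls around `x`
do not converge to `0` for any constant `c`. -/
def IsNonLebesguePoint {n : ℕ} (u : Euc n → ℝ) (x : Euc n) : Prop :=
  ¬ ∃ c : ℝ, Tendsto (fun r : ℝ => ⨍ y in Metric.ball x r, |u y - c| ∂volume)
      (𝓝[>] (0 : ℝ)) (𝓝 0)

/-- Membership in the Hölder class `C^α` on `s` (for `α ≥ 1` interpreted via
`C^{⌊α⌋, α − ⌊α⌋}`). -/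
def InHolderCls {n : ℕ} (α : ℝ) (s : Set (Euc n)) (a : Euc n → ℝ) : Prop :=
  ContDiffOn ℝ (⌊α⌋₊ : ℕ) a s ∧
    ∃ C : ℝ≥0, HolderOnWith C (Real.toNNReal (α - ⌊α⌋₊))
      (fun x => iteratedFDerivWithin ℝ ⌊α⌋₊ a s x) s

/-- The restricted Riesz potential `I₁^⋈(|f|)(x̄,0) = ∫_{C((x̄,0))} |f(y)| |x−y|^{1−d} dy`,
where `C(x)` is the double cone `{y : |ȳ − x̄| ≤ |y_d − x_d|/2}` (here `d = n+1`). -/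
def rieszBow {n : ℕ} (f : Euc (n + 1) → ℝ) (xb : Euc n) : ℝ≥0∞ :=
  ∫⁻ y : Euc (n + 1),
    ENNReal.ofReal ((if dist (frontC y) xb ≤ |lastC y| / 2 then (1 : ℝ) else 0) *
      |f y| * Real.sqrt (dist (frontC y) xb ^ 2 + lastC y ^ 2) ^ (-(n : ℝ)))

/-- The upper average `⟨f⟩⁺_{x̄,r} = ∫_{B_1} ω(y) f(x̄ + |r| ȳ, |r| y_d + |r|) dy`. -/
def avgPlus {n : ℕ} (ω : Euc (n + 1) → ℝ) (f : Euc (n + 1) → ℝ) (xb : Euc n) (r : ℝ) : ℝ :=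
  ∫ y in Metric.ball (0 : Euc (n + 1)) 1,
    ω y * f (snocC (xb + |r| • frontC y) (|r| * lastC y + |r|))

/-- The lower average `⟨f⟩⁻_{x̄,r} = ∫_{B_1} ω(y) f(x̄ + |r| ȳ, |r| y_d − |r|) dy`. -/
def avgMinus {n : ℕ} (ω : Euc (n + 1) → ℝ) (f : Euc (n + 1) → ℝ) (xb : Euc n) (r : ℝ) : ℝ :=
  ∫ y in Metric.ball (0 : Euc (n + 1)) 1,
    ω y * f (snocC (xb + |r| • frontC y) (|r| * lastC y - |r|))

open Classical in
/-- The function `u_d(x) = (1/2) sgn(x_d) θ(|x_d|/|x̄|)` (extended by its natural limit value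
`(1/2) sgn(x_d)` on the line `x̄ = 0`). -/
def uD {n : ℕ} (θ : ℝ → ℝ) (x : Euc (n + 1)) : ℝ :=
  if frontC x = 0 then (1 / 2) * Real.sign (lastC x)
  else (1 / 2) * Real.sign (lastC x) * θ (|lastC x| / ‖frontC x‖)

/-- Hypotheses on the profile function `θ`:
smooth on `(0,∞)`, `1_{(1/2,∞)} ≤ θ ≤ 1_{(1/4,∞)}` and `‖θ'‖_∞ ≤ 6`. -/
def IsProfile (θ : ℝ → ℝ) : Prop :=
  ContDiffOn ℝ (⊤ : ℕ∞) θ (Set.Ioi 0) ∧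
    (∀ t : ℝ, 0 < t → (if 1 / 2 < t then (1 : ℝ) else 0) ≤ θ t) ∧
    (∀ t : ℝ, 0 < t → θ t ≤ if 1 / 4 < t then 1 else 0) ∧
    (∀ t : ℝ, 0 < t → |deriv θ t| ≤ 6)

end

namespace CantorAux

noncomputable def P (l : ℕ → ℝ) : ℕ → ℤ → ℝ
  | 0, a => -(1 / 2 : ℝ) + 2 * a
  | n + 1, a => P l n (a / 2) + (if a % 2 = 1 then l n - l (n + 1) else 0)

lemma P_step {l : ℕ → ℝ} (h0 : l 0 = 1) (hl : ∀ j, 2 * l (j + 1) < l j) :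
    ∀ n a, P l n a + l n ≤ P l n (a + 1) := by
  intro n
  induction n with
  | zero => intro a; simp only [P, h0]; push_cast; linarith
  | succ n ih =>
    intro a
    simp only [P]
    have h2 := hl n
    rcases Int.emod_two_eq_zero_or_one a with h | h
    · have e1 : (a + 1) / 2 = a / 2 := by omega
      have e2 : (a + 1) % 2 = 1 := by omega
      rw [e1, if_pos e2, if_neg (by omega)]
      linarith
    · have e1 : (a + 1) / 2 = a / 2 + 1 := by omega
      have e2 : ¬ (a + 1) % 2 = 1 := by omega
      rw [e1, if_neg e2, if_pos h]
      have := ih (a / 2)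
      linarith

lemma P_mono {l : ℕ → ℝ} (h0 : l 0 = 1) (hp : ∀ j, 0 < l j) (hl : ∀ j, 2 * l (j + 1) < l j)
    (n : ℕ) : Monotone (P l n) := by
  apply monotone_int_of_le_succ
  intro a
  have := P_step h0 hl n a
  have := hp n
  linarith

lemma P_two {l : ℕ → ℝ} (h0 : l 0 = 1) (hp : ∀ j, 0 < l j) (hl : ∀ j, 2 * l (j + 1) < l j)
    (n : ℕ) (a b : ℤ) (h : a + 2 ≤ b) : P l n a + 2 * l n ≤ P l n b := by
  have h1 := P_step h0 hl n a
  have h2 := P_step h0 hl n (a + 1)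
  have h3 := P_mono h0 hp hl n (show a + 1 + 1 ≤ b by omega)
  linarith

lemma floor_half (t : ℝ) (n : ℕ) : ⌊t * 2 ^ (n + 1)⌋ / 2 = ⌊t * 2 ^ n⌋ := by
  have := Int.floor_div_natCast (t * 2 ^ (n + 1)) 2
  push_cast at this
  rw [← this]
  congr 1
  rw [pow_succ]; ring

noncomputable def term (l : ℕ → ℝ) (ε : ℕ → Bool) (j : ℕ) : ℝ := if ε j then l j - l (j + 1) else 0

lemma P_floor (l : ℕ → ℝ) (t : ℝ) (ht : t ∈ Set.Ico (0 : ℝ) 1) (n : ℕ) :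
    P l n ⌊t * 2 ^ n⌋ = -(1 / 2 : ℝ) + ∑ j ∈ Finset.range n, term l (binDigit t) j := by
  induction n with
  | zero =>
    have : ⌊t⌋ = 0 := by rw [Int.floor_eq_zero_iff]; exact ht
    simp [P, this]
  | succ n ih =>
    rw [P, floor_half, ih, Finset.sum_range_succ, add_assoc]
    simp [term, binDigit]

lemma l_le {l : ℕ → ℝ} (h0 : l 0 = 1) (hl : ∀ j, 2 * l (j + 1) < l j) (n : ℕ) :
    l n ≤ (1 / 2) ^ n := by
  induction n with
  | zero => simp [h0]
  | succ n ih => have := hl n; rw [pow_succ]; linarith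

lemma term_nonneg {l : ℕ → ℝ} (hp : ∀ j, 0 < l j) (hl : ∀ j, 2 * l (j + 1) < l j) (ε : ℕ → Bool)
    (j : ℕ) : 0 ≤ term l ε j := by
  unfold term; have := hl j; have := hp (j + 1); split_ifs <;> linarith

lemma term_le {l : ℕ → ℝ} (hp : ∀ j, 0 < l j) (hl : ∀ j, 2 * l (j + 1) < l j) (ε : ℕ → Bool)
    (j : ℕ) : term l ε j ≤ l j - l (j + 1) := by
  unfold term; have := hl j; have := hp (j + 1); split_ifs <;> linarith

lemma sum_le {l : ℕ → ℝ} (hp : ∀ j, 0 < l j) (hl : ∀ j, 2 * l (j + 1) < l j) (ε : ℕ → Bool)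
    (n k : ℕ) : ∑ j ∈ Finset.range k, term l ε (j + n) ≤ l n := by
  have : ∑ j ∈ Finset.range k, term l ε (j + n) ≤ l n - l (k + n) := by
    induction k with
    | zero => simp
    | succ k ih =>
      rw [Finset.sum_range_succ]
      have := term_le hp hl ε (k + n)
      rw [show k + 1 + n = k + n + 1 by ring]
      linarith
  have := hp (k + n)
  linarith

lemma summ {l : ℕ → ℝ} (hp : ∀ j, 0 < l j) (hl : ∀ j, 2 * l (j + 1) < l j) (ε : ℕ → Bool) :
    Summable (term l ε) :=
  summable_of_sum_range_le (term_nonneg hp hl ε) (fun k => by simpa using sum_le hp hl ε 0 k)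

lemma pt_bounds {l : ℕ → ℝ} (hp : ∀ j, 0 < l j) (hl : ∀ j, 2 * l (j + 1) < l j)
    (t : ℝ) (ht : t ∈ Set.Ico (0 : ℝ) 1) (n : ℕ) :
    P l n ⌊t * 2 ^ n⌋ ≤ gCantorPoint l (binDigit t) ∧
      gCantorPoint l (binDigit t) ≤ P l n ⌊t * 2 ^ n⌋ + l n := by
  have hs := summ hp hl (binDigit t)
  have e : gCantorPoint l (binDigit t) = -(1 / 2 : ℝ) + ∑' j, term l (binDigit t) j := rfl
  rw [e, P_floor l t ht, ← hs.sum_add_tsum_nat_add n]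
  have h1 : 0 ≤ ∑' j, term l (binDigit t) (j + n) := tsum_nonneg fun j => term_nonneg hp hl _ _
  have h2 : ∑' j, term l (binDigit t) (j + n) ≤ l n :=
    Real.tsum_le_of_sum_range_le (fun j => term_nonneg hp hl _ _) (sum_le hp hl _ n)
  constructor <;> linarith

lemma close {l : ℕ → ℝ} (h0 : l 0 = 1) (hp : ∀ j, 0 < l j) (hl : ∀ j, 2 * l (j + 1) < l j)
    (s t : ℝ) (hs : s ∈ Set.Ico (0 : ℝ) 1) (ht : t ∈ Set.Ico (0 : ℝ) 1) (n : ℕ)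
    (h : gCantorPoint l (binDigit t) - gCantorPoint l (binDigit s) < l n) :
    t ≤ s + 2 * (1 / 2) ^ n := by
  have hfl : ⌊t * 2 ^ n⌋ ≤ ⌊s * 2 ^ n⌋ + 1 := by
    by_contra hc
    have := P_two h0 hp hl n ⌊s * 2 ^ n⌋ ⌊t * 2 ^ n⌋ (by omega)
    have h1 := pt_bounds hp hl s hs n
    have h2 := pt_bounds hp hl t ht n
    linarith
  have h1 := Int.floor_le (s * 2 ^ n)
  have h2 := Int.lt_floor_add_one (t * 2 ^ n)
  have h3 : (⌊t * 2 ^ n⌋ : ℝ) ≤ ⌊s * 2 ^ n⌋ + 1 := by exact_mod_cast hfl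
  have h4 : t * 2 ^ n ≤ s * 2 ^ n + 2 := by linarith
  have h5 : (0 : ℝ) < 2 ^ n := by positivity
  have : (s + 2 * (1 / 2) ^ n) * 2 ^ n = s * 2 ^ n + 2 := by
    rw [add_mul, mul_assoc, ← mul_pow]; norm_num
  rw [← this] at h4
  exact le_of_mul_le_mul_right h4 h5

lemma meas_ball {l : ℕ → ℝ} (h0 : l 0 = 1) (hp : ∀ j, 0 < l j) (hl : ∀ j, 2 * l (j + 1) < l j)
    (x r : ℝ) (n : ℕ) (hr : 2 * r ≤ l n) :
    gCantorMeasure l (Metric.ball x r) ≤ ENNReal.ofReal (4 * (1 / 2) ^ n) := by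
  unfold gCantorMeasure
  by_cases hm : AEMeasurable (fun t => gCantorPoint l (binDigit t))
      (volume.restrict (Set.Ico (0 : ℝ) 1))
  swap
  · rw [Measure.map_of_not_aemeasurable hm]; simp
  rw [Measure.map_apply_of_aemeasurable hm Metric.isOpen_ball.measurableSet,
    Measure.restrict_apply' measurableSet_Ico]
  rcases Set.eq_empty_or_nonempty
    ((fun t => gCantorPoint l (binDigit t)) ⁻¹' Metric.ball x r ∩ Set.Ico (0 : ℝ) 1) with he | ⟨s, hs, hs'⟩
  · rw [he]; simp
  · have hsub : ((fun t => gCantorPoint l (binDigit t)) ⁻¹' Metric.ball x r ∩ Set.Ico (0 : ℝ) 1) ⊆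
        Set.Icc (s - 2 * (1 / 2) ^ n) (s + 2 * (1 / 2) ^ n) := by
      rintro t ⟨ht, ht'⟩
      simp only [Set.mem_preimage, Metric.mem_ball, Real.dist_eq, abs_lt] at hs ht
      have h1 := close h0 hp hl s t hs' ht' n (by linarith)
      have h2 := close h0 hp hl t s ht' hs' n (by linarith)
      exact ⟨by linarith, h1⟩
    refine (measure_mono hsub).trans ?_
    rw [Real.volume_Icc]
    apply ENNReal.ofReal_le_ofReal
    linarith

lemma meas_univ (l : ℕ → ℝ) : gCantorMeasure l Set.univ ≤ 1 := by
  unfold gCantorMeasure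
  by_cases hm : AEMeasurable (fun t => gCantorPoint l (binDigit t))
      (volume.restrict (Set.Ico (0 : ℝ) 1))
  swap
  · rw [Measure.map_of_not_aemeasurable hm]; simp
  rw [Measure.map_apply_of_aemeasurable hm MeasurableSet.univ]
  simp

instance (l : ℕ → ℝ) : IsFiniteMeasure (gCantorMeasure l) :=
  ⟨(meas_univ l).trans_lt ENNReal.one_lt_top⟩

lemma closed {l : ℕ → ℝ} (hp : ∀ j, 0 < l j) (hl : ∀ j, 2 * l (j + 1) < l j) :
    IsClosed (gCantorSet l) := by
  have hc : Continuous (gCantorPoint l) := by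
    have : gCantorPoint l = fun ε => -(1 / 2 : ℝ) + ∑' j, term l ε j := rfl
    rw [this]
    refine continuous_const.add ?_
    refine continuous_tsum (u := fun j => l j - l (j + 1)) ?_ ?_ ?_
    · intro j
      have h1 : Continuous fun b : Bool => if b then l j - l (j + 1) else 0 :=
        continuous_of_discreteTopology
      exact h1.comp (continuous_apply j)
    · exact (summ hp hl (fun _ => true)).congr (fun j => by simp [term])
    · intro j ε
      rw [Real.norm_of_nonneg (term_nonneg hp hl ε j)]
      exact term_le hp hl ε j
  exact (isCompact_range hc).isClosed

lemma meas_compl {l : ℕ → ℝ} (hp : ∀ j, 0 < l j) (hl : ∀ j, 2 * l (j + 1) < l j) :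
    gCantorMeasure l (gCantorSet l)ᶜ = 0 := by
  have hmc := (closed hp hl).measurableSet.compl
  unfold gCantorMeasure
  by_cases hm : AEMeasurable (fun t => gCantorPoint l (binDigit t))
      (volume.restrict (Set.Ico (0 : ℝ) 1))
  swap
  · rw [Measure.map_of_not_aemeasurable hm]; simp
  rw [Measure.map_apply_of_aemeasurable hm hmc]
  convert measure_empty (μ := volume.restrict (Set.Ico (0 : ℝ) 1))
  ext t
  simp [gCantorSet]

lemma pi_ball_le (l : ℕ → ℝ) (m : ℕ) (xb : Euc m) (r : ℝ) (c : ℝ≥0∞)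
    (h : ∀ x, gCantorMeasure l (Metric.ball x r) ≤ c) :
    gCantorMeasurePi l m (Metric.ball xb r) ≤ c ^ m := by
  unfold gCantorMeasurePi
  rw [MeasurableEquiv.map_apply]
  have hsub : (⇑(MeasurableEquiv.toLp 2 (Fin m → ℝ))) ⁻¹' Metric.ball xb r ⊆
      Set.univ.pi fun i => Metric.ball (xb i) r := by
    intro y hy i _
    simp only [Set.mem_preimage, Metric.mem_ball] at hy ⊢
    refine lt_of_le_of_lt ?_ hy
    rw [dist_eq_norm, dist_eq_norm]
    exact PiLp.norm_apply_le (MeasurableEquiv.toLp 2 (Fin m → ℝ) y - xb) i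
  refine (measure_mono hsub).trans ?_
  rw [Measure.pi_pi]
  refine (Finset.prod_le_prod' fun i _ => h (xb i)).trans ?_
  simp

lemma pi_ball_zero {l : ℕ → ℝ} (hp : ∀ j, 0 < l j) (hl : ∀ j, 2 * l (j + 1) < l j)
    (m : ℕ) (xb : Euc m) (r : ℝ)
    (h : ¬ Metric.infDist xb (gCantorSetPi l m) ≤ r) :
    gCantorMeasurePi l m (Metric.ball xb r) = 0 := by
  unfold gCantorMeasurePi
  rw [MeasurableEquiv.map_apply]
  have hsub : (⇑(MeasurableEquiv.toLp 2 (Fin m → ℝ))) ⁻¹' Metric.ball xb r ⊆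
      ⋃ i, Function.eval i ⁻¹' (gCantorSet l)ᶜ := by
    intro y hy
    by_contra hc
    simp only [Set.mem_iUnion, Set.mem_preimage, Set.mem_compl_iff, not_exists, not_not] at hc
    apply h
    simp only [Set.mem_preimage, Metric.mem_ball'] at hy
    refine (Metric.infDist_le_dist_of_mem (y := MeasurableEquiv.toLp 2 (Fin m → ℝ) y) ?_).trans hy.le
    exact fun i => hc i
  refine measure_mono_null hsub ?_
  rw [measure_iUnion_null_iff]
  intro i
  exact Measure.pi_eval_preimage_null _ (meas_compl hp hl)

lemma numeric {lam gam : ℝ} (hlam0 : 0 < lam) (hlam1 : lam < 1 / 2) (m : ℕ)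
    (l : ℕ → ℝ) (hl : IsCantorLengths lam gam l) :
    ∃ K : ℝ, 0 < K ∧ ∀ (r : ℝ) (n : ℕ), 0 < r → r < 1 → l (n + 1) < 2 * r →
      (n = 0 ∨ 2 * r ≤ l n) →
      ((1 / 2 : ℝ) ^ n) ^ m ≤ K * r ^ frD m lam *
        Real.log (Real.exp 1 + r⁻¹) ^ (-(gam * frD m lam)) := by
  obtain ⟨h0, hp, hl2, -, C, hC1, hC⟩ := hl
  have hC0 : 0 < C := by linarith
  have hlog2 : 0 < Real.log 2 := Real.log_pos (by norm_num)
  have hloglam : 0 < Real.log lam⁻¹ := by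
    apply Real.log_pos; rw [one_lt_inv₀ hlam0]; linarith
  set A : ℝ := Real.log (Real.exp 1 + 2 * C) + (Real.log lam⁻¹ + |gam|) with hA
  have hE : 1 ≤ Real.exp 1 := Real.one_le_exp (by norm_num)
  have hA1 : 0 < Real.log (Real.exp 1 + 2 * C) := Real.log_pos (by linarith)
  have hA0 : 0 < A := by positivity
  set K1 : ℝ := A ^ gam + Real.log 2 ^ gam with hK1
  have hK1pos : 0 < K1 := by positivity
  set K2 : ℝ := K1 * C * lam⁻¹ * 2 with hK2
  have hK2pos : 0 < K2 := by positivity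
  refine ⟨K2 ^ frD m lam, by positivity, ?_⟩
  intro r n hr hr1 hn1 hn
  set L := Real.log (Real.exp 1 + r⁻¹) with hL
  set N : ℝ := ((n + 1 : ℕ) : ℝ) with hN
  have hN1 : 1 ≤ N := by rw [hN]; push_cast; linarith [Nat.cast_nonneg (α := ℝ) n]
  have hN0 : 0 < N := by linarith
  have hCn := (hC (n + 1) (by omega)).1
  rw [← hN] at hCn
  have hrinv : 0 < r⁻¹ := by positivity
  -- lower bound of L
  have hLlow : Real.log 2 * N ≤ L := by
    rcases hn with rfl | hn
    · have : N = 1 := by rw [hN]; norm_num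
      rw [this, mul_one]
      apply Real.log_le_log (by norm_num)
      have := Real.add_one_le_exp (1 : ℝ)
      linarith
    · have h1 := l_le h0 hl2 n
      have h2 : (2 : ℝ) ^ (n + 1) ≤ r⁻¹ := by
        rw [le_inv_comm₀ (by positivity) hr, ← inv_pow, pow_succ]
        norm_num at h1 ⊢
        linarith
      rw [mul_comm, ← Real.log_pow]
      exact Real.log_le_log (by positivity) (by linarith)
  -- upper bound of L
  have hLup : L ≤ A * N := by
    have hNp : 0 < N ^ gam := by positivity
    have hNexp : N ^ (-gam) ≤ Real.exp (|gam| * N) := by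
      calc N ^ (-gam) ≤ N ^ |gam| := Real.rpow_le_rpow_of_exponent_le hN1 (neg_le_abs gam)
        _ ≤ (Real.exp N) ^ |gam| := Real.rpow_le_rpow hN0.le
            (by linarith [Real.add_one_le_exp N]) (abs_nonneg _)
        _ = Real.exp (|gam| * N) := by rw [← Real.exp_mul, mul_comm]
    have hlamexp : (lam ^ (n + 1))⁻¹ = Real.exp (Real.log lam⁻¹ * N) := by
      rw [mul_comm, hN, ← Real.log_pow, Real.exp_log (by positivity), inv_pow]
    have h1 : r⁻¹ ≤ 2 * C * Real.exp ((Real.log lam⁻¹ + |gam|) * N) := by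
      have h2 : C⁻¹ * lam ^ (n + 1) * N ^ gam ≤ 2 * r := by linarith
      have h3 : r⁻¹ ≤ 2 * (C⁻¹ * lam ^ (n + 1) * N ^ gam)⁻¹ := by
        rw [← div_eq_mul_inv, inv_eq_one_div, div_le_div_iff₀ hr (by positivity)]
        linarith
      refine h3.trans ?_
      rw [mul_inv, mul_inv, inv_inv, hlamexp, ← Real.rpow_neg hN0.le, add_mul, Real.exp_add]
      have : 0 ≤ 2 * C * Real.exp (Real.log lam⁻¹ * N) := by positivity
      nlinarith [mul_le_mul_of_nonneg_left hNexp this]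
    have hX : 1 ≤ Real.exp ((Real.log lam⁻¹ + |gam|) * N) := Real.one_le_exp (by positivity)
    have h4 : Real.exp 1 + r⁻¹ ≤
        (Real.exp 1 + 2 * C) * Real.exp ((Real.log lam⁻¹ + |gam|) * N) := by
      nlinarith
    calc L ≤ Real.log ((Real.exp 1 + 2 * C) * Real.exp ((Real.log lam⁻¹ + |gam|) * N)) :=
          Real.log_le_log (by positivity) h4
      _ = Real.log (Real.exp 1 + 2 * C) + (Real.log lam⁻¹ + |gam|) * N := by
          rw [Real.log_mul (by positivity) (by positivity), Real.log_exp]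
      _ ≤ A * N := by rw [hA]; nlinarith
  have hL0 : 0 < L := lt_of_lt_of_le (by positivity) hLlow
  have hLg : L ^ gam ≤ K1 * N ^ gam := by
    have hNp : 0 < N ^ gam := by positivity
    rcases le_total 0 gam with hg | hg
    · calc L ^ gam ≤ (A * N) ^ gam := Real.rpow_le_rpow hL0.le hLup hg
        _ = A ^ gam * N ^ gam := Real.mul_rpow hA0.le hN0.le
        _ ≤ K1 * N ^ gam := by
          apply mul_le_mul_of_nonneg_right _ hNp.le
          have : 0 < Real.log 2 ^ gam := by positivity
          linarith
    · calc L ^ gam ≤ (Real.log 2 * N) ^ gam :=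
            Real.rpow_le_rpow_of_nonpos (by positivity) hLlow hg
        _ = Real.log 2 ^ gam * N ^ gam := Real.mul_rpow hlog2.le hN0.le
        _ ≤ K1 * N ^ gam := by
          apply mul_le_mul_of_nonneg_right _ hNp.le
          have : 0 < A ^ gam := by positivity
          linarith
  have hmain : lam ^ n ≤ K2 * r * L ^ (-gam) := by
    rw [Real.rpow_neg hL0.le, ← div_eq_mul_inv, le_div_iff₀ (by positivity)]
    calc lam ^ n * L ^ gam ≤ lam ^ n * (K1 * N ^ gam) :=
          mul_le_mul_of_nonneg_left hLg (by positivity)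
      _ = K1 * C * lam⁻¹ * (C⁻¹ * lam ^ (n + 1) * N ^ gam) := by
          rw [pow_succ]; field_simp
      _ ≤ K1 * C * lam⁻¹ * (2 * r) :=
          mul_le_mul_of_nonneg_left (by linarith) (by positivity)
      _ = K2 * r := by rw [hK2]; ring
  have hD0 : 0 ≤ frD m lam := by unfold frD; positivity
  have hlamD : lam ^ frD m lam = (1 / 2 : ℝ) ^ m := by
    rw [Real.rpow_def_of_pos hlam0, ← Real.exp_log (show (0:ℝ) < (1 / 2) ^ m by positivity),
      Real.log_pow]
    congr 1
    unfold frD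
    rw [Real.log_inv] at hloglam ⊢
    rw [one_div, Real.log_inv]
    have : Real.log lam ≠ 0 := by linarith
    field_simp
  calc ((1 / 2 : ℝ) ^ n) ^ m = (lam ^ n) ^ frD m lam := by
        rw [← pow_mul, mul_comm, pow_mul, ← hlamD, ← Real.rpow_natCast, ← Real.rpow_natCast,
          ← Real.rpow_mul hlam0.le, ← Real.rpow_mul hlam0.le, mul_comm]
    _ ≤ (K2 * r * L ^ (-gam)) ^ frD m lam := Real.rpow_le_rpow (by positivity) hmain hD0
    _ = _ := by
      rw [Real.mul_rpow (by positivity) (by positivity), Real.mul_rpow hK2pos.le hr.le,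
        ← Real.rpow_mul hL0.le, neg_mul]

lemma exists_n {l : ℕ → ℝ} (h0 : l 0 = 1) (hl : ∀ j, 2 * l (j + 1) < l j)
    (r : ℝ) (hr : 0 < r) : ∃ n, l (n + 1) < 2 * r ∧ (n = 0 ∨ 2 * r ≤ l n) := by
  classical
  have hex : ∃ n, l (n + 1) < 2 * r := by
    obtain ⟨n, hn⟩ := exists_pow_lt_of_lt_one hr (show (1 / 2 : ℝ) < 1 by norm_num)
    refine ⟨n, ?_⟩
    have h1 := l_le h0 hl (n + 1)
    rw [pow_succ] at h1
    linarith
  refine ⟨Nat.find hex, Nat.find_spec hex, ?_⟩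
  rcases Nat.eq_zero_or_pos (Nat.find hex) with h | h
  · exact Or.inl h
  · right
    have := Nat.find_min hex (m := Nat.find hex - 1) (by omega)
    rw [Nat.sub_add_cancel h] at this
    linarith

end CantorAux

/-- Upper bound for the Cantor measure of balls:
`μ^m_{λ,γ}(B^m_r(x̄)) ≤ C · 1_{dist(x̄,𝔠^m_{λ,γ}) ≤ r} · r^𝔇 · (log(e + r⁻¹))^{−γ𝔇}`. -/
theorem cantor_measure_ball_estimate
    {d m k : ℕ} (hd : d = m + k) (hd2 : 2 ≤ d) (hm : 1 ≤ m) (hk : 1 ≤ k)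
    {lam gam : ℝ} (hlam0 : 0 < lam) (hlam1 : lam < 1 / 2)
    (l : ℕ → ℝ) (hl : IsCantorLengths lam gam l) :
    ∃ C : ℝ, 0 < C ∧ ∀ (xb : Euc m) (r : ℝ), 0 < r → r < 1 →
      gCantorMeasurePi l m (Metric.ball xb r) ≤
        ENNReal.ofReal (C *
          (if Metric.infDist xb (gCantorSetPi l m) ≤ r then 1 else 0) *
          r ^ frD m lam * Real.log (Real.exp 1 + r⁻¹) ^ (-(gam * frD m lam))) := by
  obtain ⟨K, hK, hnum⟩ := CantorAux.numeric hlam0 hlam1 m l hl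
  obtain ⟨h0, hp, hl2, -, -⟩ := hl
  refine ⟨4 ^ m * K, by positivity, ?_⟩
  intro xb r hr hr1
  by_cases hd : Metric.infDist xb (gCantorSetPi l m) ≤ r
  swap
  · rw [CantorAux.pi_ball_zero hp hl2 m xb r hd]; simp
  rw [if_pos hd, mul_one]
  obtain ⟨n, hn1, hn2⟩ := CantorAux.exists_n h0 hl2 r hr
  have hb : ∀ x, gCantorMeasure l (Metric.ball x r) ≤ ENNReal.ofReal (4 * (1 / 2) ^ n) := by
    intro x
    rcases hn2 with rfl | h
    · refine ((measure_mono (Set.subset_univ _)).trans (CantorAux.meas_univ l)).trans ?_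
      rw [← ENNReal.ofReal_one]
      exact ENNReal.ofReal_le_ofReal (by norm_num)
    · exact CantorAux.meas_ball h0 hp hl2 x r n h
  refine (CantorAux.pi_ball_le l m xb r _ hb).trans ?_
  rw [← ENNReal.ofReal_pow (by positivity)]
  apply ENNReal.ofReal_le_ofReal
  rw [mul_pow]
  have := mul_le_mul_of_nonneg_left (hnum r n hr hr1 hn1 hn2) (show (0 : ℝ) ≤ 4 ^ m by positivity)
  refine this.trans (le_of_eq (by ring))
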